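/- Let K be a field, S a positive normal affine semigroup with gp(S) = ℤ^r, support forms σ_1,…,σ_s, and R = K[S]. There exist only finitely many classes c ∈ Cl(R) = ℤ^s/σ(ℤ^r) such that for a representative a ∈ ℤ^s of c the divisorial ideal D(a) is a Cohen–Macaulay R-module. -/

import Mathlib

set_option synthInstance.maxHeartbeats 1000000
set_option maxHeartbeats 1000000

open scoped BigOperators

noncomputable section

/-- Pairing of an integral linear form (given by its coefficient vector `f`) with `x`. -/
def lin {r : ℕ} (f x : Fin r → ℤ) : ℤ := ∑ k, f k * x k

lemma lin_zero {r : ℕ} (f : Fin r → ℤ) : lin f 0 = 0 := by simp [lin]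

lemma lin_add {r : ℕ} (f x y : Fin r → ℤ) : lin f (x + y) = lin f x + lin f y := by
  simp [lin, mul_add, Finset.sum_add_distrib]

/-- A family of integral linear forms, bundled as an additive homomorphism `ℤ^r → ℤ^s`. -/
def formsHom {r s : ℕ} (σ : Fin s → Fin r → ℤ) : (Fin r → ℤ) →+ (Fin s → ℤ) where
  toFun x i := lin (σ i) x
  map_zero' := by funext i; simp [lin_zero]
  map_add' x y := by funext i; simp [lin_add]

/-- The subgroup `σ(ℤ^r) ⊆ ℤ^s`. -/
def formsRange {r s : ℕ} (σ : Fin s → Fin r → ℤ) : AddSubgroup (Fin s → ℤ) :=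
  (formsHom σ).range

/-- The divisor class group `Cl(R) = ℤ^s / σ(ℤ^r)`. -/
abbrev classGroup {r s : ℕ} (σ : Fin s → Fin r → ℤ) : Type :=
  (Fin s → ℤ) ⧸ formsRange σ

/-- The set of solutions of the inhomogeneous system of inequalities `σ_i(x) ≥ a_i`. -/
def Tset {r s : ℕ} (σ : Fin s → Fin r → ℤ) (a : Fin s → ℤ) : Set (Fin r → ℤ) :=
  {x | ∀ i, a i ≤ lin (σ i) x}

/-- The monomial of exponent `x` in the group algebra `K[ℤ^r]`. -/
def mono (K : Type*) [Field K] {r : ℕ} (x : Fin r → ℤ) : AddMonoidAlgebra K (Fin r → ℤ) :=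
  AddMonoidAlgebra.single x 1

/-- The affine semigroup ring `K[S]`, as a subalgebra of `K[ℤ^r]`. -/
def semigroupRing (K : Type*) [Field K] {r : ℕ} (S : AddSubmonoid (Fin r → ℤ)) :
    Subalgebra K (AddMonoidAlgebra K (Fin r → ℤ)) :=
  Algebra.adjoin K {f | ∃ x ∈ S, f = mono K x}

/-- The monomial (fractional) ideal of `K[S]` with monomial basis `T ⊆ ℤ^r`, as a
`K[S]`-submodule of `K[ℤ^r]`.  (When `S + T ⊆ T`, its underlying set is the `K`-span
of the monomials with exponents in `T`.) -/
def monIdeal (K : Type*) [Field K] {r : ℕ} (S : AddSubmonoid (Fin r → ℤ))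
    (T : Set (Fin r → ℤ)) :
    Submodule ↥(semigroupRing K S) (AddMonoidAlgebra K (Fin r → ℤ)) :=
  Submodule.span _ {f | ∃ x ∈ T, f = mono K x}

/-- The maximal ideal of `K[S]` generated by all nonunit monomials. -/
def irrelevantIdeal (K : Type*) [Field K] {r : ℕ} (S : AddSubmonoid (Fin r → ℤ)) :
    Ideal ↥(semigroupRing K S) :=
  Ideal.span {f | ∃ x ∈ S, x ≠ 0 ∧ (f : AddMonoidAlgebra K (Fin r → ℤ)) = mono K x}

/-- `M` is a Cohen–Macaulay module with respect to the ideal `I ⊆ R`: the length of a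
maximal `M`-regular sequence contained in `I` equals the Krull dimension of `M`
(the Krull dimension of `R/ann(M)`). -/
def IsCohenMacaulayMod (R : Type*) [CommRing R] (I : Ideal R)
    (M : Type*) [AddCommGroup M] [Module R M] : Prop :=
  ∃ rs : List R, (∀ x ∈ rs, x ∈ I) ∧ RingTheory.Sequence.IsRegular M rs ∧
    (∀ y ∈ I, ¬ RingTheory.Sequence.IsRegular M (rs ++ [y])) ∧
    (rs.length : WithBot ℕ∞) = ringKrullDim (R ⧸ Module.annihilator R M)

section Koszul

variable {ι : Type*} [LinearOrder ι]

/-- The sign of removing `j` from `L` in the Koszul cochain complex. -/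
def koszulSign (R : Type*) [CommRing R] (j : ι) (L : Finset ι) : R :=
  (-1) ^ (L.filter (· < j)).card

lemma koszulSign_mul_self (R : Type*) [CommRing R] (j : ι) (L : Finset ι) :
    koszulSign R j L * koszulSign R j L = 1 := by
  simp [koszulSign, ← mul_pow]

lemma koszulSign_erase_of_le (R : Type*) [CommRing R] {j k : ι} (L : Finset ι) (h : j ≤ k) :
    koszulSign R j (L.erase k) = koszulSign R j L := by
  unfold koszulSign
  rw [Finset.filter_erase, Finset.erase_eq_of_notMem]
  simp [h]

lemma koszulSign_erase_of_lt (R : Type*) [CommRing R] {j k : ι} {L : Finset ι} (hk : k ∈ L)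
    (h : k < j) : koszulSign R j (L.erase k) = -koszulSign R j L := by
  unfold koszulSign
  have hmem : k ∈ L.filter (· < j) := by simp [hk, h]
  rw [Finset.filter_erase, ← Finset.card_erase_add_one hmem, pow_succ]
  ring

lemma koszulSign_mul_erase (R : Type*) [CommRing R] {j k : ι} {L : Finset ι} (hj : j ∈ L)
    (hk : k ∈ L) (hjk : j ≠ k) :
    koszulSign R j L * koszulSign R k (L.erase j) =
      -(koszulSign R k L * koszulSign R j (L.erase k)) := by
  rcases lt_or_gt_of_ne hjk with h | h
  · rw [koszulSign_erase_of_lt R hj h, koszulSign_erase_of_le R L h.le]; ring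
  · rw [koszulSign_erase_of_lt R hk h, koszulSign_erase_of_le R L h.le]; ring

lemma koszulSign_insert_self (R : Type*) [CommRing R] (j : ι) (L : Finset ι) :
    koszulSign R j (insert j L) = koszulSign R j L := by
  unfold koszulSign
  rw [Finset.filter_insert, if_neg (lt_irrefl j)]

variable {R : Type*} [CommRing R] {M : Type*} [AddCommGroup M] [Module R M]

/-- The Koszul differential of the family `f` with coefficients in `M`, acting on all cochains
at once; the component of degree `k` consists of the cochains supported on `k`-subsets. -/
def koszulD (f : ι → R) : (Finset ι → M) →ₗ[R] (Finset ι → M) where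
  toFun c L := ∑ j ∈ L, (koszulSign R j L * f j) • c (L.erase j)
  map_add' c c' := by
    funext L
    simp [smul_add, Finset.sum_add_distrib]
  map_smul' a c := by
    funext L
    simp only [Pi.smul_apply, RingHom.id_apply, Finset.smul_sum]
    exact Finset.sum_congr rfl fun j _ => smul_comm _ _ _

lemma koszulD_apply (f : ι → R) (c : Finset ι → M) (L : Finset ι) :
    koszulD f c L = ∑ j ∈ L, (koszulSign R j L * f j) • c (L.erase j) := rfl

lemma koszulD_koszulD (f : ι → R) (c : Finset ι → M) : koszulD f (koszulD f c) = 0 := by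
  funext L
  simp only [koszulD_apply, Finset.smul_sum, smul_smul, Pi.zero_apply]
  rw [Finset.sum_sigma']
  refine Finset.sum_involution (fun p _ => ⟨p.2, p.1⟩) ?_ ?_ ?_ ?_
  · rintro ⟨j, k⟩ hp
    simp only [Finset.mem_sigma, Finset.mem_erase] at hp
    obtain ⟨hj, hkj, hk⟩ := hp
    rw [Finset.erase_right_comm, ← add_smul]
    have h := koszulSign_mul_erase R hj hk hkj.symm
    convert zero_smul R _
    linear_combination f j * f k * h
  · rintro ⟨j, k⟩ hp _ h
    simp only [Finset.mem_sigma, Finset.mem_erase] at hp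
    simp only [Sigma.mk.injEq] at h
    exact hp.2.1 h.1
  · rintro ⟨j, k⟩ hp
    simp only [Finset.mem_sigma, Finset.mem_erase] at hp ⊢
    exact ⟨hp.2.2, hp.2.1.symm, hp.1⟩
  · rintro ⟨j, k⟩ hp
    rfl

/-- Contraction of Koszul cochains with the basis vector `j`. -/
def koszulContract (R : Type*) [CommRing R] {M : Type*} [AddCommGroup M] [Module R M] (j : ι)
    (c : Finset ι → M) : Finset ι → M :=
  fun L => if j ∈ L then 0 else koszulSign R j L • c (insert j L)

lemma koszulD_contract_of_koszulD_eq_zero (f : ι → R) (j : ι) {c : Finset ι → M}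
    (hc : koszulD f c = 0) : koszulD f (koszulContract R j c) = f j • c := by
  funext L
  rw [koszulD_apply, Pi.smul_apply]
  by_cases hj : j ∈ L
  · rw [Finset.sum_eq_single_of_mem j hj]
    · rw [koszulContract, if_neg (Finset.notMem_erase j L), Finset.insert_erase hj,
        koszulSign_erase_of_le R L le_rfl, smul_smul]
      congr 1
      linear_combination f j * koszulSign_mul_self R j L
    · intro k _ hkj
      rw [koszulContract, if_pos (Finset.mem_erase.2 ⟨hkj.symm, hj⟩), smul_zero]
  · have h0 : koszulSign R j L • koszulD f c (insert j L) = 0 := by simp [hc]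
    rw [koszulD_apply, Finset.sum_insert hj, Finset.erase_insert hj, smul_add, smul_smul,
      ← mul_assoc, koszulSign_insert_self, koszulSign_mul_self, one_mul, Finset.smul_sum] at h0
    rw [eq_neg_of_add_eq_zero_left h0, ← Finset.sum_neg_distrib]
    refine Finset.sum_congr rfl fun k hk => ?_
    have hkj : k ≠ j := fun h => hj (h ▸ hk)
    have hj' : j ∉ L.erase k := fun h => hj (Finset.mem_of_mem_erase h)
    rw [koszulContract, if_neg hj', smul_smul, smul_smul, ← neg_smul,
      Finset.erase_insert_of_ne hkj.symm]
    congr 1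
    have h := koszulSign_mul_erase R (Finset.mem_insert_self j L) (Finset.mem_insert_of_mem hk)
      hkj.symm
    rw [Finset.erase_insert hj, Finset.erase_insert_of_ne hkj.symm, koszulSign_insert_self,
      koszulSign_insert_self] at h
    have hj2 := koszulSign_mul_self R j L
    have hj3 := koszulSign_mul_self R j (L.erase k)
    linear_combination f k * (koszulSign R j L * koszulSign R j (L.erase k) * h
      - koszulSign R k L * koszulSign R j (L.erase k) * hj2
      - koszulSign R k (insert j L) * koszulSign R j L * hj3)

/-- Koszul cohomology in degree `k` is annihilated by the ideal generated by the family. -/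
lemma exists_koszulD_eq_smul {f : ι → R} {k : ℕ} {c : Finset ι → M}
    (hsupp : ∀ L, c L ≠ 0 → L.card = k) (hc : koszulD f c = 0) {a : R}
    (ha : a ∈ Ideal.span (Set.range f)) :
    ∃ b : Finset ι → M, (∀ L, b L ≠ 0 → L.card + 1 = k) ∧ koszulD f b = a • c := by
  induction ha using Submodule.span_induction with
  | mem x hx =>
    obtain ⟨j, rfl⟩ := hx
    refine ⟨koszulContract R j c, fun L hL => ?_, koszulD_contract_of_koszulD_eq_zero f j hc⟩
    unfold koszulContract at hL
    split_ifs at hL with hj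
    · exact absurd rfl hL
    · rw [← hsupp _ (right_ne_zero_of_smul hL), Finset.card_insert_of_notMem hj]
  | zero => exact ⟨0, fun L hL => absurd rfl hL, by simp⟩
  | add x y _ _ hx hy =>
    obtain ⟨b, hb, hbc⟩ := hx
    obtain ⟨b', hb', hbc'⟩ := hy
    refine ⟨b + b', fun L hL => ?_, by rw [map_add, hbc, hbc', add_smul]⟩
    by_cases h : b L = 0
    · exact hb' L fun h' => hL (by simp [h, h'])
    · exact hb L h
  | smul r x _ hx =>
    obtain ⟨b, hb, hbc⟩ := hx
    refine ⟨r • b, fun L hL => hb L (right_ne_zero_of_smul hL), ?_⟩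
    rw [map_smul, hbc, smul_smul, smul_eq_mul]

open RingTheory.Sequence in
/-- Koszul cohomology vanishes below the length of a weakly regular sequence in the radical of
the ideal generated by the family. -/
theorem exists_koszulD_eq_of_isWeaklyRegular (f : ι → R) (rs : List R)
    (hrs : ∀ x ∈ rs, x ∈ (Ideal.span (Set.range f)).radical) {M : Type*} [AddCommGroup M]
    [Module R M] (hreg : IsWeaklyRegular M rs) {k : ℕ} (hk : k < rs.length) {c : Finset ι → M}
    (hsupp : ∀ L, c L ≠ 0 → L.card = k) (hc : koszulD f c = 0) :
    ∃ b : Finset ι → M, (∀ L, b L ≠ 0 → L.card + 1 = k) ∧ koszulD f b = c := by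
  induction rs generalizing M k with
  | nil => simp at hk
  | cons y rs ih =>
    obtain ⟨hy, hrest⟩ := (isWeaklyRegular_cons_iff M y rs).1 hreg
    obtain ⟨e, he⟩ := hrs y List.mem_cons_self
    obtain ⟨b, hb, hbc⟩ := exists_koszulD_eq_smul hsupp hc he
    clear he
    induction e generalizing b with
    | zero => exact ⟨b, hb, by rw [hbc, pow_zero, one_smul]⟩
    | succ e ihe =>
      let q : M →ₗ[R] QuotSMulTop y M := Submodule.mkQ _
      have hq0 : ∀ m : M, q m = 0 ↔ ∃ m', y • m' = m := by
        intro m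
        rw [Submodule.mkQ_apply, Submodule.Quotient.mk_eq_zero,
          Submodule.mem_smul_pointwise_iff_exists]
        simp
      have hqD : ∀ b' : Finset ι → M, koszulD f (fun L => q (b' L)) =
          fun L => q (koszulD f b' L) := by
        intro b'
        funext L
        simp [koszulD_apply]
      obtain ⟨b', hb', hbb'⟩ : ∃ b' : Finset ι → M, (∀ L, b' L ≠ 0 → L.card + 1 + 1 = k) ∧
          ∀ L, q (koszulD f b' L) = q (b L) := by
        rcases Nat.eq_zero_or_pos k with rfl | hk0
        · refine ⟨0, fun L hL => absurd rfl hL, fun L => ?_⟩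
          have : b L = 0 := by
            by_contra h
            exact absurd (hb L h) (by omega)
          simp [this]
        · obtain ⟨c', hc', hcc'⟩ := ih (fun x hx => hrs x (List.mem_cons_of_mem _ hx)) hrest
            (k := k - 1) (c := fun L => q (b L)) (by simp at hk; omega)
            (fun L hL => by
              have := hb L (fun h => hL (by simp [h]))
              omega)
            (by
              rw [hqD]
              funext L
              refine (hq0 _).2 ⟨y ^ e • c L, ?_⟩
              rw [hbc, Pi.smul_apply, smul_smul, pow_succ'])
          have hsurj : ∀ L, ∃ m, q m = c' L ∧ (c' L = 0 → m = 0) := by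
            intro L
            by_cases h : c' L = 0
            · exact ⟨0, by simp [h], fun _ => rfl⟩
            · obtain ⟨m, hm⟩ := Submodule.mkQ_surjective _ (c' L)
              exact ⟨m, hm, fun h' => absurd h' h⟩
          choose b' hb' hb'0 using hsurj
          refine ⟨b', fun L hL => ?_, fun L => ?_⟩
          · have := hc' L (fun h => hL (hb'0 L h))
            omega
          · have := congrFun (hqD b') L
            rw [← this, ← congrFun hcc' L, funext hb']
      have hdiv : ∀ L, ∃ m, y • m = b L - koszulD f b' L ∧ (m ≠ 0 → L.card + 1 = k) := by
        intro L
        by_cases hL : L.card + 1 = k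
        · obtain ⟨m, hm⟩ := (hq0 (b L - koszulD f b' L)).1 (by rw [map_sub, hbb', sub_self])
          exact ⟨m, hm, fun _ => hL⟩
        · refine ⟨0, ?_, fun h => absurd rfl h⟩
          have h1 : b L = 0 := by
            by_contra h
            exact hL (hb L h)
          have h2 : koszulD f b' L = 0 := by
            refine Finset.sum_eq_zero fun j hj => ?_
            have : b' (L.erase j) = 0 := by
              by_contra h
              have := hb' _ h
              rw [Finset.card_erase_add_one hj] at this
              exact hL this
            rw [this, smul_zero]
          rw [h1, h2, smul_zero, sub_zero]
      choose b'' hb'' hb''k using hdiv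
      refine ihe b'' (fun L hL => hb''k L hL) ?_
      have hyb : y • b'' = b - koszulD f b' := funext hb''
      have hyD : y • koszulD f b'' = y • (y ^ e • c) := by
        rw [← map_smul, hyb, map_sub, koszulD_koszulD, sub_zero, hbc, smul_smul, pow_succ']
      funext L
      exact hy (congrFun hyD L)

/-- The complex of cochains supported on the subsets `L ⊆ A` on which no form `v i`, `i ∈ N`,
vanishes identically is exact above the rank of the forms `v i`. -/
theorem exists_koszulD_eq_of_finrank_lt {κ F W : Type*} [Field F] [AddCommGroup W] [Module F W]
    [FiniteDimensional F W] [DecidableEq κ] (K : Type*) [Field K] (v : κ → W) (e : ι → W →ₗ[F] F)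
    (N : Finset κ) (A : Finset ι) (Y : Submodule F W) (hA : ∀ j ∈ A, ∀ w ∈ Y, e j w = 0) {k : ℕ}
    (hk : Module.finrank F ↥(Y ⊔ Submodule.span F (v '' N)) < k + Module.finrank F Y)
    {c : Finset ι → K}
    (hsupp : ∀ L, c L ≠ 0 → L ⊆ A ∧ L.card = k ∧ ∀ i ∈ N, ∃ j ∈ L, e j (v i) ≠ 0)
    (hc : koszulD (fun j => if j ∈ A then (1 : K) else 0) c = 0) :
    ∃ b : Finset ι → K,
      (∀ L, b L ≠ 0 → L ⊆ A ∧ L.card + 1 = k ∧ ∀ i ∈ N, ∃ j ∈ L, e j (v i) ≠ 0) ∧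
      koszulD (fun j => if j ∈ A then (1 : K) else 0) b = c := by
  induction N using Finset.induction_on generalizing A Y k c with
  | empty =>
    have hk0 : 0 < k := by
      have := Submodule.finrank_mono
        (le_sup_left : Y ≤ Y ⊔ Submodule.span F (v '' ((∅ : Finset κ) : Set κ)))
      omega
    rcases A.eq_empty_or_nonempty with rfl | ⟨j, hj⟩
    · have : c = 0 := by
        funext L
        by_contra h
        obtain ⟨h1, h2, -⟩ := hsupp L h
        rw [Finset.subset_empty.1 h1, Finset.card_empty] at h2
        omega
      exact ⟨0, fun L hL => absurd rfl hL, by rw [this, map_zero]⟩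
    · refine ⟨koszulContract K j c, fun L hL => ?_, ?_⟩
      · unfold koszulContract at hL
        split_ifs at hL with hjL
        · exact absurd rfl hL
        · obtain ⟨h1, h2, -⟩ := hsupp _ (right_ne_zero_of_smul hL)
          rw [Finset.card_insert_of_notMem hjL] at h2
          exact ⟨(Finset.subset_insert j L).trans h1, h2, by simp⟩
      · rw [koszulD_contract_of_koszulD_eq_zero _ j hc, if_pos hj, one_smul]
  | insert i N hi ih =>
    by_cases hiY : v i ∈ Y
    · have : c = 0 := by
        funext L
        by_contra h
        obtain ⟨h1, -, h3⟩ := hsupp L h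
        obtain ⟨j, hj, hne⟩ := h3 i (Finset.mem_insert_self i N)
        exact hne (hA j (h1 hj) _ hiY)
      exact ⟨0, fun L hL => absurd rfl hL, by rw [this, map_zero]⟩
    have hle : Y ⊔ Submodule.span F (v '' N) ≤ Y ⊔ Submodule.span F (v '' (insert i N :)) :=
      sup_le_sup_left (Submodule.span_mono (Set.image_mono (by simp))) _
    obtain ⟨b, hb, hbc⟩ := ih A Y hA (lt_of_le_of_lt (Submodule.finrank_mono hle) hk)
      (fun L hL => ⟨(hsupp L hL).1, (hsupp L hL).2.1,
        fun i' hi' => (hsupp L hL).2.2 i' (Finset.mem_insert_of_mem hi')⟩) hc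
    set Y' := Y ⊔ Submodule.span F {v i} with hY'
    have hYY' : Module.finrank F Y < Module.finrank F Y' := by
      refine Submodule.finrank_lt_finrank_of_lt (lt_of_le_of_ne le_sup_left fun h => hiY ?_)
      rw [h]
      exact le_sup_right (a := Y) (Submodule.mem_span_singleton_self (v i))
    have hY'N : Y' ⊔ Submodule.span F (v '' N) = Y ⊔ Submodule.span F (v '' (insert i N :)) := by
      rw [Finset.coe_insert, Set.image_insert_eq, Submodule.span_insert, hY', sup_assoc]
    have hYk : Module.finrank F Y' ≤
        Module.finrank F ↥(Y ⊔ Submodule.span F (v '' (insert i N :))) := by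
      rw [← hY'N]
      exact Submodule.finrank_mono le_sup_left
    classical
    set A' := A.filter fun j => e j (v i) = 0 with hA'
    have hAA' : A' ⊆ A := Finset.filter_subset _ _
    have hA'e : ∀ j ∈ A', ∀ w ∈ Y', e j w = 0 := by
      intro j hj w hw
      have hj' := Finset.mem_filter.1 hj
      have : Y' ≤ LinearMap.ker (e j) := by
        refine sup_le (fun w hw => hA j hj'.1 w hw) ?_
        rw [Submodule.span_singleton_le_iff_mem]
        exact hj'.2
      exact this hw
    have hagree : ∀ (b b' : Finset ι → K), (∀ L ⊆ A', b' L = b L) → ∀ L ⊆ A',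
        koszulD (fun j => if j ∈ A' then (1 : K) else 0) b' L =
          koszulD (fun j => if j ∈ A then (1 : K) else 0) b L := by
      intro b b' h L hL
      refine Finset.sum_congr rfl fun j hj => ?_
      beta_reduce
      rw [if_pos (hL hj), if_pos (hAA' (hL hj)), h _ ((Finset.erase_subset j L).trans hL)]
    let b' : Finset ι → K := fun L => if L ⊆ A' then b L else 0
    obtain ⟨b'', hb'', hbb''⟩ := ih A' Y' hA'e (k := k - 1) (c := b')
      (by rw [hY'N]; omega)
      (fun L hL => by
        simp only [b'] at hL
        split_ifs at hL with hLA
        · obtain ⟨-, h2, h3⟩ := hb L hL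
          exact ⟨hLA, by omega, h3⟩
        · exact absurd rfl hL)
      (by
        funext L
        by_cases hL : L ⊆ A'
        · rw [hagree b b' (fun L hL => by simp only [b', if_pos hL]) L hL, hbc]
          by_contra h
          obtain ⟨-, -, h3⟩ := hsupp L h
          obtain ⟨j, hj, hne⟩ := h3 i (Finset.mem_insert_self i N)
          exact hne (Finset.mem_filter.1 (hL hj)).2
        · refine Finset.sum_eq_zero fun j hj => ?_
          by_cases hjA : j ∈ A'
          · have : ¬ L.erase j ⊆ A' := fun h => hL fun x hx => by
              by_cases hxj : x = j
              · rwa [hxj]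
              · exact h (Finset.mem_erase.2 ⟨hxj, hx⟩)
            simp only [b', if_neg this, smul_zero]
          · simp [hjA])
    refine ⟨b - koszulD (fun j => if j ∈ A then (1 : K) else 0) b'', fun L hL => ?_, by
      rw [map_sub, koszulD_koszulD, sub_zero, hbc]⟩
    have hgood : L ⊆ A ∧ L.card + 1 = k ∧ ∀ i ∈ N, ∃ j ∈ L, e j (v i) ≠ 0 := by
      by_cases hbL : b L = 0
      · have hne : koszulD (fun j => if j ∈ A then (1 : K) else 0) b'' L ≠ 0 := by
          intro h
          exact hL (by simp [hbL, h])
        obtain ⟨j, hj, hjne⟩ := Finset.exists_ne_zero_of_sum_ne_zero hne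
        have hjA : j ∈ A := by
          by_contra h
          simp [h] at hjne
        obtain ⟨h1, h2, h3⟩ := hb'' _ (right_ne_zero_of_smul hjne)
        rw [Finset.card_erase_add_one hj] at h2
        refine ⟨fun x hx => ?_, by omega, fun i' hi' => ?_⟩
        · by_cases hxj : x = j
          · rwa [hxj]
          · exact hAA' (h1 (Finset.mem_erase.2 ⟨hxj, hx⟩))
        · obtain ⟨j', hj', h'⟩ := h3 i' hi'
          exact ⟨j', Finset.mem_of_mem_erase hj', h'⟩
      · exact hb L hbL
    refine ⟨hgood.1, hgood.2.1, fun i' hi' => ?_⟩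
    rcases Finset.mem_insert.1 hi' with rfl | hi'
    · by_contra! h
      have hLA' : L ⊆ A' := fun j hj => Finset.mem_filter.2 ⟨hgood.1 hj, h j hj⟩
      apply hL
      rw [Pi.sub_apply, ← hagree b'' b'' (fun _ _ => rfl) L hLA', hbb'']
      simp only [b', if_pos hLA', sub_self]
    · exact hgood.2.2 i' hi'

/-- The Euler characteristic of an exact complex of cochains supported on an upward closed family
of finite sets vanishes. -/
theorem sum_neg_one_pow_card_eq_zero [Fintype ι] (K : Type*) [Field K] (P : Finset ι → Prop)
    [DecidablePred P] (hP : ∀ L L', L ⊆ L' → P L → P L')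
    (hexact : ∀ k (c : Finset ι → K), (∀ L, c L ≠ 0 → P L ∧ L.card = k) →
      koszulD (fun _ => (1 : K)) c = 0 →
      ∃ b : Finset ι → K, (∀ L, b L ≠ 0 → P L ∧ L.card + 1 = k) ∧
        koszulD (fun _ => (1 : K)) b = c) :
    ∑ L : Finset ι, (if P L then (-1 : ℤ) ^ L.card else 0) = 0 := by
  let D : (Finset ι → K) →ₗ[K] (Finset ι → K) := koszulD (fun _ => (1 : K))
  let E : ℕ → Submodule K (Finset ι → K) := fun k =>
    { carrier := {c | ∀ L, c L ≠ 0 → P L ∧ L.card = k}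
      zero_mem' := fun L hL => absurd rfl hL
      add_mem' := by
        intro a b ha hb L hL
        by_cases h : a L = 0
        · exact hb L fun h' => hL (by simp [h, h'])
        · exact ha L h
      smul_mem' := fun a c hc L hL => hc L fun h => hL (by simp [h]) }
  have hE : ∀ k, Module.finrank K (E k) =
      (Finset.univ.filter fun L : Finset ι => P L ∧ L.card = k).card := by
    intro k
    let φ : E k ≃ₗ[K] ((Finset.univ.filter fun L : Finset ι => P L ∧ L.card = k) → K) :=
      { toFun := fun c L => c.1 L.1
        map_add' := fun _ _ => rfl
        map_smul' := fun _ _ => rfl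
        invFun := fun c => ⟨fun L => if h : P L ∧ L.card = k then
            c ⟨L, Finset.mem_filter.2 ⟨Finset.mem_univ L, h⟩⟩ else 0,
          fun L hL => by
            by_contra h
            exact hL (dif_neg h)⟩
        left_inv := by
          intro c
          ext L
          by_cases h : P L ∧ L.card = k
          · simp [h]
          · have : c.1 L = 0 := by
              by_contra h'
              exact h (c.2 L h')
            simp only [dif_neg h, this]
        right_inv := by
          intro c
          funext L
          have h : P L.1 ∧ L.1.card = k := (Finset.mem_filter.1 L.2).2
          simp only [dif_pos h] }
    rw [φ.finrank_eq, Module.finrank_fintype_fun_eq_card, Fintype.card_coe]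
  have hDE : ∀ k, ∀ c ∈ E k, D c ∈ E (k + 1) := by
    intro k c hc L hL
    obtain ⟨j, hj, hjne⟩ := Finset.exists_ne_zero_of_sum_ne_zero hL
    obtain ⟨h1, h2⟩ := hc _ (right_ne_zero_of_smul hjne)
    refine ⟨hP _ _ (Finset.erase_subset j L) h1, ?_⟩
    rw [← h2, Finset.card_erase_add_one hj]
  let z : ℕ → ℕ := fun k => Module.finrank K ↥(E k ⊓ LinearMap.ker D)
  have hz : ∀ k, Module.finrank K (E k) = z k + z (k + 1) := by
    intro k
    have h1 := LinearMap.finrank_range_add_finrank_ker (D.domRestrict (E k))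
    have h2 : LinearMap.range (D.domRestrict (E k)) = E (k + 1) ⊓ LinearMap.ker D := by
      ext c
      constructor
      · rintro ⟨b, rfl⟩
        exact ⟨hDE k _ b.2, koszulD_koszulD _ _⟩
      · rintro ⟨hc, hcD⟩
        obtain ⟨b, hb, hbc⟩ := hexact (k + 1) c hc hcD
        exact ⟨⟨b, fun L hL => ⟨(hb L hL).1, by have := (hb L hL).2; omega⟩⟩, hbc⟩
    have h3 : Module.finrank K (LinearMap.ker (D.domRestrict (E k))) = z k := by
      have h4 : LinearMap.ker (D.domRestrict (E k)) =
          Submodule.comap (E k).subtype (E k ⊓ LinearMap.ker D) := by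
        ext c
        simp [LinearMap.mem_ker]
      rw [h4]
      exact (Submodule.comapSubtypeEquivOfLe inf_le_left).finrank_eq
    rw [h2, h3] at h1
    simp only [z] at h1 ⊢
    omega
  have hz0 : z 0 = 0 := by
    rw [Submodule.finrank_eq_zero, eq_bot_iff]
    rintro c ⟨hc, hcD⟩
    obtain ⟨b, hb, hbc⟩ := hexact 0 c hc hcD
    have : b = 0 := by
      funext L
      by_contra h
      exact absurd (hb L h).2 (by omega)
    rw [Submodule.mem_bot, ← hbc, this, map_zero]
  have hzn : z (Fintype.card ι + 1) = 0 := by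
    rw [Submodule.finrank_eq_zero, eq_bot_iff]
    rintro c ⟨hc, -⟩
    rw [Submodule.mem_bot]
    funext L
    by_contra h
    have := (hc L h).2
    have := Finset.card_le_univ L
    omega
  have htel : ∀ n, ∑ k ∈ Finset.range (n + 1), (-1 : ℤ) ^ k * Module.finrank K (E k) =
      (-1) ^ n * z (n + 1) := by
    intro n
    induction n with
    | zero => simp [hz, hz0]
    | succ n ih =>
      rw [Finset.sum_range_succ, ih, hz, pow_succ]
      push_cast
      ring
  have hsum : ∑ L : Finset ι, (if P L then (-1 : ℤ) ^ L.card else 0) =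
      ∑ k ∈ Finset.range (Fintype.card ι + 1), (-1 : ℤ) ^ k * Module.finrank K (E k) := by
    rw [← Finset.sum_fiberwise_of_maps_to (s := Finset.univ)
      (t := Finset.range (Fintype.card ι + 1)) (g := Finset.card)
      (fun L _ => Finset.mem_range.2 (Nat.lt_succ_of_le (Finset.card_le_univ L)))]
    refine Finset.sum_congr rfl fun k _ => ?_
    rw [hE, ← Finset.sum_filter, Finset.filter_filter, Finset.sum_congr rfl
      (g := fun _ => (-1 : ℤ) ^ k) fun L hL => by rw [(Finset.mem_filter.1 hL).2.1],
      Finset.sum_const, nsmul_eq_mul, mul_comm]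
    congr 3
    ext L
    simp [and_comm]
  rw [hsum, htel, hzn]
  simp

end Koszul

section MonomialModules

variable {K : Type*} [Field K] {r : ℕ}

lemma mono_add (x y : Fin r → ℤ) : mono K (x + y) = mono K x * mono K y := by
  simp [mono]

lemma mono_nsmul (t : ℕ) (x : Fin r → ℤ) : mono K (t • x) = mono K x ^ t := by
  simp [mono]

lemma mono_mem_semigroupRing {S : AddSubmonoid (Fin r → ℤ)} {x : Fin r → ℤ} (hx : x ∈ S) :
    mono K x ∈ semigroupRing K S :=
  Algebra.subset_adjoin ⟨x, hx, rfl⟩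

lemma coeff_mul_eq_zero_of_notMem {S : AddSubmonoid (Fin r → ℤ)} {T : Set (Fin r → ℤ)}
    (hT : ∀ x ∈ S, ∀ y ∈ T, x + y ∈ T) {f : AddMonoidAlgebra K (Fin r → ℤ)}
    (hf : f ∈ semigroupRing K S) (m : AddMonoidAlgebra K (Fin r → ℤ))
    (hm : ∀ z, z ∉ T → m.coeff z = 0) (z : Fin r → ℤ) (hz : z ∉ T) : (f * m).coeff z = 0 := by
  induction hf using Algebra.adjoin_induction generalizing m z with
  | mem f hf =>
    obtain ⟨x, hx, rfl⟩ := hf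
    rw [mono, AddMonoidAlgebra.coeff_single_mul_apply, one_mul]
    refine hm _ fun h => hz ?_
    have := hT x hx _ h
    rwa [add_neg_cancel_left] at this
  | algebraMap k =>
    rw [← Algebra.smul_def, AddMonoidAlgebra.coeff_smul, Finsupp.smul_apply, hm z hz, smul_zero]
  | add f g _ _ hf hg =>
    rw [add_mul, AddMonoidAlgebra.coeff_add, Finsupp.add_apply, hf m hm z hz, hg m hm z hz,
      add_zero]
  | mul f g _ _ hf hg =>
    rw [mul_assoc]
    exact hf _ (hg m hm) z hz

lemma coeff_eq_zero_of_mem_monIdeal {S : AddSubmonoid (Fin r → ℤ)} {T : Set (Fin r → ℤ)}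
    (hT : ∀ x ∈ S, ∀ y ∈ T, x + y ∈ T) {m : AddMonoidAlgebra K (Fin r → ℤ)}
    (hm : m ∈ monIdeal K S T) {z : Fin r → ℤ} (hz : z ∉ T) : m.coeff z = 0 := by
  induction hm using Submodule.span_induction generalizing z with
  | mem m hm =>
    obtain ⟨x, hx, rfl⟩ := hm
    rw [mono, AddMonoidAlgebra.coeff_single, Finsupp.single_apply, if_neg]
    rintro rfl
    exact hz hx
  | zero => rfl
  | add f g _ _ hf hg =>
    rw [AddMonoidAlgebra.coeff_add, Finsupp.add_apply, hf hz, hg hz, add_zero]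
  | smul a m _ hm =>
    exact coeff_mul_eq_zero_of_notMem hT a.2 m (fun z hz => hm hz) z hz

lemma single_mem_monIdeal {S : AddSubmonoid (Fin r → ℤ)} {T : Set (Fin r → ℤ)} {z : Fin r → ℤ}
    (hz : z ∈ T) (k : K) : AddMonoidAlgebra.single z k ∈ monIdeal K S T := by
  have h : AddMonoidAlgebra.single z k =
      (algebraMap K (semigroupRing K S) k) • mono K z := by
    rw [algebraMap_smul, mono, AddMonoidAlgebra.smul_single, smul_eq_mul, mul_one]
  rw [h]
  exact Submodule.smul_mem _ _ (Submodule.subset_span ⟨z, hz, rfl⟩)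

lemma add_mem_Tset {s : ℕ} {S : AddSubmonoid (Fin r → ℤ)} {σ : Fin s → Fin r → ℤ}
    (hrep : ∀ x : Fin r → ℤ, x ∈ S ↔ ∀ i, 0 ≤ lin (σ i) x) (a : Fin s → ℤ) :
    ∀ x ∈ S, ∀ y ∈ Tset σ a, x + y ∈ Tset σ a := by
  intro x hx y hy i
  have h1 := (hrep x).1 hx i
  have h2 : a i ≤ lin (σ i) y := hy i
  rw [lin_add]
  omega

variable {n : ℕ} {S : AddSubmonoid (Fin r → ℤ)}

/-- The `t`-th powers of the monomials with exponents `g j`, as elements of `K[S]`. -/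
def monoPow (K : Type*) [Field K] (g : Fin n → Fin r → ℤ) (hg : ∀ j, g j ∈ S) (t : ℕ)
    (j : Fin n) : semigroupRing K S :=
  ⟨mono K (t • g j), mono_mem_semigroupRing (S.nsmul_mem (hg j) t)⟩

lemma eq_zero_or_eq_gen_add {g : Fin n → Fin r → ℤ}
    (hgS : AddSubmonoid.closure (Set.range g) = S) {x : Fin r → ℤ} (hx : x ∈ S) :
    x = 0 ∨ ∃ j, ∃ y ∈ S, x = g j + y := by
  subst hgS
  induction hx using AddSubmonoid.closure_induction with
  | mem x hx =>
    obtain ⟨j, rfl⟩ := hx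
    exact Or.inr ⟨j, 0, zero_mem _, by simp⟩
  | zero => exact Or.inl rfl
  | add x y hx hy ihx ihy =>
    rcases ihx with rfl | ⟨j, z, hz, rfl⟩
    · rwa [zero_add]
    · exact Or.inr ⟨j, z + y, add_mem hz hy, add_assoc _ _ _⟩

lemma irrelevantIdeal_le_radical {g : Fin n → Fin r → ℤ} (hg : ∀ j, g j ∈ S)
    (hgS : AddSubmonoid.closure (Set.range g) = S) (t : ℕ) :
    irrelevantIdeal K S ≤ (Ideal.span (Set.range (monoPow K g hg t))).radical := by
  refine Ideal.span_le.2 ?_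
  rintro f ⟨x, hxS, hx0, hf⟩
  obtain ⟨j, y, hy, rfl⟩ := (eq_zero_or_eq_gen_add hgS hxS).resolve_left hx0
  refine ⟨t, ?_⟩
  have : f ^ t = ⟨mono K (t • y), mono_mem_semigroupRing (S.nsmul_mem hy t)⟩ *
      monoPow K g hg t j := by
    apply Subtype.ext
    simp only [SubmonoidClass.coe_pow, MulMemClass.coe_mul, monoPow]
    rw [hf, ← mono_nsmul, ← mono_add, smul_add, add_comm]
  rw [this]
  exact Ideal.mul_mem_left _ _ (Ideal.subset_span ⟨j, rfl⟩)

lemma koszulSign_smul_eq_or_eq_neg {ι : Type*} [LinearOrder ι] {R M : Type*} (R' : Type*)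
    [CommRing R] [AddCommGroup M] [Module R M] [CommRing R'] (j : ι) (L : Finset ι) (x : M) :
    koszulSign R j L • x = x ∧ koszulSign R' j L = 1 ∨
      koszulSign R j L • x = -x ∧ koszulSign R' j L = -1 := by
  rcases Nat.even_or_odd (L.filter (· < j)).card with h | h
  · exact Or.inl ⟨by rw [koszulSign, h.neg_one_pow, one_smul], h.neg_one_pow⟩
  · exact Or.inr ⟨by rw [koszulSign, h.neg_one_pow, neg_one_smul], h.neg_one_pow⟩

lemma coeff_koszulD_monoPow {T : Set (Fin r → ℤ)} {g : Fin n → Fin r → ℤ} (hg : ∀ j, g j ∈ S)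
    (t : ℕ) (c : Finset (Fin n) → monIdeal K S T) (L : Finset (Fin n)) (z : Fin r → ℤ) :
    ((koszulD (monoPow K g hg t) c L : monIdeal K S T) : AddMonoidAlgebra K (Fin r → ℤ)).coeff z =
      ∑ j ∈ L, koszulSign K j L *
        (c (L.erase j) : AddMonoidAlgebra K (Fin r → ℤ)).coeff (z - t • g j) := by
  rw [koszulD_apply, Submodule.coe_sum, AddMonoidAlgebra.coeff_sum, Finsupp.finsetSum_apply]
  refine Finset.sum_congr rfl fun j _ => ?_
  rw [mul_smul]
  have h : ((monoPow K g hg t j • c (L.erase j) : monIdeal K S T) :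
      AddMonoidAlgebra K (Fin r → ℤ)).coeff z =
      (c (L.erase j) : AddMonoidAlgebra K (Fin r → ℤ)).coeff (z - t • g j) := by
    change (AddMonoidAlgebra.single (t • g j) (1 : K) * (c (L.erase j)).1).coeff z = _
    rw [AddMonoidAlgebra.coeff_single_mul_apply, one_mul, neg_add_eq_sub]
  rcases koszulSign_smul_eq_or_eq_neg (R := semigroupRing K S) K j L
    (monoPow K g hg t j • c (L.erase j)) with ⟨h1, h2⟩ | ⟨h1, h2⟩
  · rw [h1, h2, one_mul, h]
  · rw [h1, h2, neg_one_mul, ← h]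
    rfl

/-- The graded pieces of the Koszul complex of a monomial module: the subset `L` contributes at
degree `x` if every coordinate violating the inequalities is moved by some generator in `L`. -/
def KoszulSupport {s : ℕ} (σ : Fin s → Fin r → ℤ) (a : Fin s → ℤ) (g : Fin n → Fin r → ℤ)
    (x : Fin r → ℤ) (L : Finset (Fin n)) : Prop :=
  ∀ i, lin (σ i) x < a i → ∃ j ∈ L, lin (σ i) (g j) ≠ 0

lemma lin_nsmul (f : Fin r → ℤ) (t : ℕ) (x : Fin r → ℤ) : lin f (t • x) = t * lin f x := by
  simp only [lin, Pi.smul_apply, nsmul_eq_mul, Finset.mul_sum]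
  exact Finset.sum_congr rfl fun _ _ => by ring

lemma lin_sum {ι : Type*} (f : Fin r → ℤ) (L : Finset ι) (x : ι → Fin r → ℤ) :
    lin f (∑ j ∈ L, x j) = ∑ j ∈ L, lin f (x j) := by
  simp only [lin, Finset.sum_apply, Finset.mul_sum]
  exact Finset.sum_comm

lemma koszulSupport_iff {s : ℕ} {σ : Fin s → Fin r → ℤ} {a : Fin s → ℤ} {g : Fin n → Fin r → ℤ}
    (hg : ∀ i j, 0 ≤ lin (σ i) (g j)) {x : Fin r → ℤ} {t : ℕ}
    (ht : ∀ i, a i - lin (σ i) x ≤ t) (L : Finset (Fin n)) :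
    KoszulSupport σ a g x L ↔ x + t • ∑ j ∈ L, g j ∈ Tset σ a := by
  refine forall_congr' fun i => ?_
  rw [lin_add, lin_nsmul, lin_sum]
  constructor
  · intro h
    by_cases hi : lin (σ i) x < a i
    · obtain ⟨j, hj, hne⟩ := h hi
      have h1 : lin (σ i) (g j) ≤ ∑ j ∈ L, lin (σ i) (g j) :=
        Finset.single_le_sum (fun k _ => hg i k) hj
      have h2 : 1 ≤ ∑ j ∈ L, lin (σ i) (g j) := by have := hg i j; omega
      nlinarith [ht i]
    · have h1 : 0 ≤ ∑ j ∈ L, lin (σ i) (g j) := Finset.sum_nonneg fun k _ => hg i k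
      have : (0 : ℤ) ≤ t * ∑ j ∈ L, lin (σ i) (g j) := by positivity
      omega
  · intro h hi
    by_contra! h0
    rw [Finset.sum_eq_zero h0] at h
    omega

open RingTheory.Sequence in
/-- A weakly regular sequence in the irrelevant ideal makes each graded piece of the Koszul
complex of a monomial module exact in low degrees. -/
lemma exists_koszulD_eq_of_koszulSupport {s : ℕ} {σ : Fin s → Fin r → ℤ} {a : Fin s → ℤ}
    {g : Fin n → Fin r → ℤ} (hrep : ∀ x : Fin r → ℤ, x ∈ S ↔ ∀ i, 0 ≤ lin (σ i) x)
    (hg : ∀ j, g j ∈ S) (hgS : AddSubmonoid.closure (Set.range g) = S)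
    {rs : List (semigroupRing K S)} (hrs : ∀ x ∈ rs, x ∈ irrelevantIdeal K S)
    (hreg : IsWeaklyRegular (monIdeal K S (Tset σ a)) rs) (x : Fin r → ℤ) {k : ℕ}
    (hk : k < rs.length) {c : Finset (Fin n) → K}
    (hsupp : ∀ L, c L ≠ 0 → KoszulSupport σ a g x L ∧ L.card = k)
    (hc : koszulD (fun _ => (1 : K)) c = 0) :
    ∃ b : Finset (Fin n) → K, (∀ L, b L ≠ 0 → KoszulSupport σ a g x L ∧ L.card + 1 = k) ∧
      koszulD (fun _ => (1 : K)) b = c := by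
  classical
  obtain ⟨t, ht⟩ : ∃ t : ℕ, ∀ i, a i - lin (σ i) x ≤ t := by
    refine ⟨∑ i, (a i - lin (σ i) x).toNat, fun i => (Int.self_le_toNat _).trans ?_⟩
    exact_mod_cast Finset.single_le_sum (f := fun i => (a i - lin (σ i) x).toNat)
      (fun _ _ => Nat.zero_le _) (Finset.mem_univ i)
  have hiff := koszulSupport_iff (fun i j => (hrep _).1 (hg j) i) ht
  let p : Finset (Fin n) → Fin r → ℤ := fun L => x + t • ∑ j ∈ L, g j
  have hp : ∀ L, ∀ j ∈ L, p L - t • g j = p (L.erase j) := by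
    intro L j hj
    simp only [p]
    rw [← Finset.add_sum_erase L g hj, smul_add]
    abel
  have hmem : ∀ L, AddMonoidAlgebra.single (p L) (c L) ∈ monIdeal K S (Tset σ a) := by
    intro L
    by_cases h : c L = 0
    · rw [h, AddMonoidAlgebra.single_zero]
      exact zero_mem _
    · exact single_mem_monIdeal ((hiff L).1 (hsupp L h).1) _
  let C : Finset (Fin n) → monIdeal K S (Tset σ a) := fun L => ⟨_, hmem L⟩
  have hC : koszulD (monoPow K g hg t) C = 0 := by
    funext L
    apply Subtype.ext
    apply AddMonoidAlgebra.ext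
    ext z
    rw [coeff_koszulD_monoPow]
    simp only [C, AddMonoidAlgebra.coeff_single]
    change _ = (0 : K)
    by_cases hz : z = p L
    · subst hz
      refine Eq.trans ?_ (congr_fun hc L)
      rw [koszulD_apply]
      refine Finset.sum_congr rfl fun j hj => ?_
      rw [hp L j hj, Finsupp.single_eq_same, mul_one, smul_eq_mul]
    · refine Finset.sum_eq_zero fun j hj => ?_
      rw [Finsupp.single_apply, if_neg, mul_zero]
      rw [← hp L j hj]
      intro h
      exact hz (sub_left_injective h).symm
  obtain ⟨b, hb, hbC⟩ := exists_koszulD_eq_of_isWeaklyRegular (monoPow K g hg t) rs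
    (fun x hx => irrelevantIdeal_le_radical hg hgS t (hrs x hx)) hreg hk (c := C)
    (fun L hL => (hsupp L fun h => hL (Subtype.ext (by simp [C, h]))).2) hC
  refine ⟨fun L => (b L).1.coeff (p L), fun L hL => ⟨?_, hb L ?_⟩, ?_⟩
  · rw [hiff]
    by_contra h
    exact hL (coeff_eq_zero_of_mem_monIdeal (add_mem_Tset hrep a) (b L).2 h)
  · intro h
    exact hL (by simp only [h]; rfl)
  · funext L
    have h := coeff_koszulD_monoPow hg t b L (p L)
    rw [hbC] at h
    simp only [C, AddMonoidAlgebra.coeff_single, Finsupp.single_eq_same] at h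
    rw [h, koszulD_apply]
    refine Finset.sum_congr rfl fun j hj => ?_
    rw [hp L j hj, mul_one, smul_eq_mul]

end MonomialModules

section Dimension

variable {K : Type*} [Field K] {r : ℕ}

lemma annihilator_monIdeal {S : AddSubmonoid (Fin r → ℤ)} {T : Set (Fin r → ℤ)}
    (hT : T.Nonempty) : Module.annihilator (semigroupRing K S) (monIdeal K S T) = ⊥ := by
  obtain ⟨z, hz⟩ := hT
  rw [eq_bot_iff]
  intro f hf
  rw [Module.mem_annihilator] at hf
  have h : f.1 * mono K z = 0 :=
    congrArg Subtype.val (hf ⟨mono K z, Submodule.subset_span ⟨z, hz, rfl⟩⟩)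
  have h1 : mono K z * mono K (-z) = 1 := by
    rw [← mono_add, add_neg_cancel]
    rfl
  rw [Ideal.mem_bot]
  apply Subtype.ext
  rw [← mul_one f.1, ← h1, ← mul_assoc, h, zero_mul]
  rfl

/-- The additive endomorphism of `ℤ^r` setting the first `k` coordinates to zero. -/
def dropCoords (r k : ℕ) : (Fin r → ℤ) →+ (Fin r → ℤ) where
  toFun x i := if (i : ℕ) < k then 0 else x i
  map_zero' := by funext i; simp
  map_add' x y := by funext i; by_cases h : (i : ℕ) < k <;> simp [h]

lemma dropCoords_apply (k : ℕ) (x : Fin r → ℤ) (i : Fin r) :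
    dropCoords r k x i = if (i : ℕ) < k then 0 else x i := rfl

/-- The prime ideal of `K[S]` of elements killed by forgetting the first `k` coordinates of the
exponents. -/
def dropPrime (K : Type*) [Field K] (S : AddSubmonoid (Fin r → ℤ)) (k : ℕ) :
    PrimeSpectrum (semigroupRing K S) :=
  ⟨RingHom.ker ((AddMonoidAlgebra.mapDomainRingHom K (dropCoords r k)).comp
    (semigroupRing K S).val.toRingHom), RingHom.ker_isPrime _⟩

lemma mem_dropPrime {S : AddSubmonoid (Fin r → ℤ)} {k : ℕ} {f : semigroupRing K S} :
    f ∈ (dropPrime K S k).asIdeal ↔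
      AddMonoidAlgebra.mapDomainRingHom K (dropCoords r k) f.1 = 0 := Iff.rfl

lemma dropPrime_lt {S : AddSubmonoid (Fin r → ℤ)}
    (hSgp : ∀ x : Fin r → ℤ, ∃ a ∈ S, ∃ b ∈ S, x = a - b) (k : Fin r) :
    dropPrime K S k < dropPrime K S (k + 1) := by
  refine lt_of_le_not_ge (fun f hf => ?_) fun hle => ?_
  · rw [mem_dropPrime] at hf ⊢
    have h : (dropCoords r (k + 1)).comp (dropCoords r k) = dropCoords r (k + 1) := by
      ext x i
      simp only [AddMonoidHom.comp_apply, dropCoords_apply]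
      split_ifs <;> omega
    rw [← h, AddMonoidAlgebra.mapDomainRingHom_comp, RingHom.comp_apply, hf, map_zero]
  · obtain ⟨a, ha, b, hb, hab⟩ := hSgp (Pi.single k 1)
    have hmap : ∀ (l : ℕ) (x : Fin r → ℤ), AddMonoidAlgebra.mapDomainRingHom K (dropCoords r l)
        (mono K x) = mono K (dropCoords r l x) := fun l x => by simp [mono]
    have hmem : (⟨mono K a - mono K b, sub_mem (mono_mem_semigroupRing ha)
        (mono_mem_semigroupRing hb)⟩ : semigroupRing K S) ∈ (dropPrime K S (k + 1)).asIdeal := by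
      rw [mem_dropPrime, map_sub, hmap, hmap, sub_eq_zero]
      congr 1
      rw [← sub_eq_zero, ← map_sub, ← hab]
      funext i
      rw [dropCoords_apply]
      split_ifs with h
      · rfl
      · rw [Pi.single_eq_of_ne, Pi.zero_apply]
        rintro rfl
        omega
    have h := hle hmem
    rw [mem_dropPrime, map_sub, hmap, hmap, sub_eq_zero, mono, mono] at h
    have h' := AddMonoidAlgebra.single_left_injective one_ne_zero h
    rw [← sub_eq_zero, ← map_sub, ← hab] at h'
    have := congr_fun h' k
    simp [dropCoords_apply] at this

lemma le_ringKrullDim_semigroupRing {S : AddSubmonoid (Fin r → ℤ)}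
    (hSgp : ∀ x : Fin r → ℤ, ∃ a ∈ S, ∃ b ∈ S, x = a - b) :
    (r : WithBot ℕ∞) ≤ ringKrullDim (semigroupRing K S) := by
  let c : LTSeries (PrimeSpectrum (semigroupRing K S)) :=
    { length := r
      toFun := fun k => dropPrime K S k
      step := fun k => dropPrime_lt hSgp k }
  exact Order.LTSeries.length_le_krullDim c

lemma le_ringKrullDim_quotient_annihilator {S : AddSubmonoid (Fin r → ℤ)} {T : Set (Fin r → ℤ)}
    (hSgp : ∀ x : Fin r → ℤ, ∃ a ∈ S, ∃ b ∈ S, x = a - b) (hT : T.Nonempty) :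
    (r : WithBot ℕ∞) ≤ ringKrullDim
      (semigroupRing K S ⧸ Module.annihilator (semigroupRing K S) (monIdeal K S T)) := by
  rw [annihilator_monIdeal hT]
  exact (le_ringKrullDim_semigroupRing hSgp).trans_eq
    (ringKrullDim_eq_of_ringEquiv (RingEquiv.quotientBot _).symm)

end Dimension

section Minimal

variable {K : Type*} [Field K] {r s n : ℕ} {S : AddSubmonoid (Fin r → ℤ)}
  {σ : Fin s → Fin r → ℤ} {a : Fin s → ℤ} {g : Fin n → Fin r → ℤ}

lemma lin_sub (f x y : Fin r → ℤ) : lin f (x - y) = lin f x - lin f y := by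
  simp [lin, mul_sub, Finset.sum_sub_distrib]

lemma koszulSupport_sub_gen {x : Fin r → ℤ} {L : Finset (Fin n)} {j : Fin n} (hj : j ∈ L) :
    KoszulSupport σ a g (x - g j) L ↔ KoszulSupport σ a g x L := by
  refine forall_congr' fun i => ?_
  by_cases h : lin (σ i) (g j) = 0
  · rw [lin_sub, h, sub_zero]
  · exact iff_of_true (fun _ => ⟨j, hj, h⟩) fun _ => ⟨j, hj, h⟩

open Classical in
/-- The Euler characteristics of the graded pieces of the Koszul complex detect the minimal
generators of `T(a)`. -/
lemma exists_sum_koszulSupport_ne_zero (hg : ∀ i j, 0 ≤ lin (σ i) (g j)) {y : Fin r → ℤ}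
    (hy : y ∈ Tset σ a) (hmin : ∀ j, y - g j ∉ Tset σ a) :
    ∃ J : Finset (Fin n), ∑ L : Finset (Fin n),
      (if KoszulSupport σ a g (y - ∑ j ∈ J, g j) L then (-1 : ℤ) ^ L.card else 0) ≠ 0 := by
  by_contra! h0
  have h1 : ∑ L : Finset (Fin n), ∑ J : Finset (Fin n), (-1 : ℤ) ^ J.card *
      (if KoszulSupport σ a g (y - ∑ j ∈ J, g j) L then (-1 : ℤ) ^ L.card else 0) = 0 := by
    rw [Finset.sum_comm]
    refine Finset.sum_eq_zero fun J _ => ?_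
    rw [← Finset.mul_sum, h0, mul_zero]
  rw [Finset.sum_eq_single_of_mem ∅ (Finset.mem_univ _)] at h1
  · rw [Finset.sum_eq_single_of_mem ∅ (Finset.mem_univ _)] at h1
    · rw [if_pos] at h1
      · simp at h1
      · intro i hi
        rw [Finset.sum_empty, sub_zero] at hi
        exact absurd (hy i) hi.not_ge
    · intro J _ hJ
      obtain ⟨j, hj⟩ := Finset.nonempty_iff_ne_empty.2 hJ
      rw [if_neg, mul_zero]
      intro h
      refine hmin j fun i => ?_
      have h2 : a i ≤ lin (σ i) (y - ∑ j ∈ J, g j) := by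
        by_contra! h2
        obtain ⟨k, hk, -⟩ := h i h2
        exact absurd hk (Finset.notMem_empty k)
      have h3 : lin (σ i) (g j) ≤ ∑ j ∈ J, lin (σ i) (g j) :=
        Finset.single_le_sum (fun k _ => hg i k) hj
      rw [lin_sub, lin_sum] at h2
      rw [lin_sub]
      omega
  · intro L _ hL
    obtain ⟨j, hj⟩ := Finset.nonempty_iff_ne_empty.2 hL
    have hstep : ∀ J : Finset (Fin n), j ∉ J →
        (KoszulSupport σ a g (y - ∑ j ∈ insert j J, g j) L ↔
          KoszulSupport σ a g (y - ∑ j ∈ J, g j) L) := by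
      intro J hJ
      rw [Finset.sum_insert hJ, ← sub_sub, sub_right_comm]
      exact koszulSupport_sub_gen hj
    refine Finset.sum_involution (fun J _ => if j ∈ J then J.erase j else insert j J) ?_ ?_
      (fun _ _ => Finset.mem_univ _) ?_
    · intro J _
      by_cases hJ : j ∈ J
      · have := hstep (J.erase j) (Finset.notMem_erase j J)
        rw [Finset.insert_erase hJ] at this
        rw [if_pos hJ, this, ← Finset.card_erase_add_one hJ]
        ring
      · rw [if_neg hJ, hstep J hJ, Finset.card_insert_of_notMem hJ]
        ring
    · intro J _ _ h
      by_cases hJ : j ∈ J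
      · rw [if_pos hJ] at h
        exact Finset.notMem_erase j J (h.symm ▸ hJ)
      · rw [if_neg hJ] at h
        exact hJ (h ▸ Finset.mem_insert_self j J)
    · intro J _
      by_cases hJ : j ∈ J
      · rw [if_pos hJ, if_neg (Finset.notMem_erase j J), Finset.insert_erase hJ]
      · rw [if_neg hJ, if_pos (Finset.mem_insert_self j J), Finset.erase_insert hJ]

/-- Pairing with an integral vector, as a rational linear form. -/
def ratPairing (x : Fin r → ℤ) : (Fin r → ℚ) →ₗ[ℚ] ℚ :=
  ∑ k, (x k : ℚ) • LinearMap.proj k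

lemma ratPairing_cast (f x : Fin r → ℤ) : ratPairing x (fun k => (f k : ℚ)) = lin f x := by
  simp [ratPairing, lin, mul_comm]

lemma eq_zero_of_ratPairing_eq_zero {x : Fin r → ℤ} (h : ratPairing x = 0) : x = 0 := by
  funext k
  have := LinearMap.congr_fun h (Pi.single k 1)
  simpa [ratPairing, Pi.single_apply] using this

open RingTheory.Sequence in
/-- If `D(a)` has depth at least `r`, then the forms that almost attain their bound at a minimal
generator separate points. -/
lemma eq_zero_of_lin_eq_zero_of_minimal
    (hrep : ∀ x : Fin r → ℤ, x ∈ S ↔ ∀ i, 0 ≤ lin (σ i) x)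
    (hg : ∀ j, g j ∈ S) (hgS : AddSubmonoid.closure (Set.range g) = S)
    {rs : List (semigroupRing K S)} (hrs : ∀ x ∈ rs, x ∈ irrelevantIdeal K S)
    (hreg : IsWeaklyRegular (monIdeal K S (Tset σ a)) rs) (hr : r ≤ rs.length)
    {y : Fin r → ℤ} (hy : y ∈ Tset σ a) (hmin : ∀ j, y - g j ∉ Tset σ a) {x : Fin r → ℤ}
    (hx : ∀ i, lin (σ i) y < a i + lin (σ i) (∑ j, g j) → lin (σ i) x = 0) : x = 0 := by
  classical
  have hg' : ∀ i j, 0 ≤ lin (σ i) (g j) := fun i j => (hrep _).1 (hg j) i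
  obtain ⟨J, hJ⟩ := exists_sum_koszulSupport_ne_zero hg' hy hmin
  set z := y - ∑ j ∈ J, g j with hz
  set N : Finset (Fin s) := Finset.univ.filter fun i => lin (σ i) z < a i with hN
  set v : Fin s → Fin r → ℚ := fun i k => (σ i k : ℚ) with hv
  by_cases hspan : Submodule.span ℚ (v '' N) = ⊤
  · refine eq_zero_of_ratPairing_eq_zero ?_
    refine LinearMap.ext_on hspan ?_
    rintro _ ⟨i, hi, rfl⟩
    rw [hv, ratPairing_cast, hx i, LinearMap.zero_apply, Int.cast_zero]
    have h1 : lin (σ i) z < a i := by simpa [hN] using hi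
    have h2 : ∑ j ∈ J, lin (σ i) (g j) ≤ ∑ j, lin (σ i) (g j) :=
      Finset.sum_le_sum_of_subset_of_nonneg (Finset.subset_univ _) fun k _ _ => hg' i k
    rw [hz, lin_sub, lin_sum] at h1
    rw [lin_sum]
    omega
  · exfalso
    have hlt : Module.finrank ℚ (Submodule.span ℚ (v '' N)) < r := by
      simpa using Submodule.finrank_lt hspan
    refine hJ (sum_neg_one_pow_card_eq_zero K _ (fun L L' hL h i hi => ?_) fun k c hsupp hc => ?_)
    · obtain ⟨j, hj, hne⟩ := h i hi
      exact ⟨j, hL hj, hne⟩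
    rcases lt_or_ge k rs.length with hk | hk
    · exact exists_koszulD_eq_of_koszulSupport hrep hg hgS hrs hreg z hk hsupp hc
    · have hiff : ∀ L, KoszulSupport σ a g z L ↔
          ∀ i ∈ N, ∃ j ∈ L, ratPairing (g j) (v i) ≠ 0 := by
        intro L
        simp [KoszulSupport, hN, hv, ratPairing_cast]
      obtain ⟨b, hb, hbc⟩ := exists_koszulD_eq_of_finrank_lt K v (fun j => ratPairing (g j)) N
        Finset.univ (k := k) (c := c) ⊥ (fun j _ w hw => by
          rw [(Submodule.mem_bot ℚ).1 hw, map_zero])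
        (by rw [bot_sup_eq, finrank_bot]; omega)
        (fun L hL => ⟨Finset.subset_univ _, (hsupp L hL).2, (hiff L).1 (hsupp L hL).1⟩)
        (by simpa using hc)
      exact ⟨b, fun L hL => ⟨(hiff L).2 (hb L hL).2.2, (hb L hL).2.1⟩, by simpa using hbc⟩

end Minimal

section Cone

variable {r s n : ℕ} {S : AddSubmonoid (Fin r → ℤ)} {σ : Fin s → Fin r → ℤ} {a : Fin s → ℤ}
  {g : Fin n → Fin r → ℤ}

lemma lin_neg (f x : Fin r → ℤ) : lin f (-x) = -lin f x := by simp [lin]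

lemma lin_zsmul (f : Fin r → ℤ) (t : ℤ) (x : Fin r → ℤ) : lin f (t • x) = t * lin f x := by
  simp only [lin, Pi.smul_apply, smul_eq_mul, Finset.mul_sum]
  exact Finset.sum_congr rfl fun _ _ => by ring

lemma exists_forall_lin_pos (hSgp : ∀ x : Fin r → ℤ, ∃ a ∈ S, ∃ b ∈ S, x = a - b)
    (hrep : ∀ x : Fin r → ℤ, x ∈ S ↔ ∀ i, 0 ≤ lin (σ i) x)
    (hirr : ∀ j, ∃ x : Fin r → ℤ, lin (σ j) x < 0 ∧ ∀ i, i ≠ j → 0 ≤ lin (σ i) x) :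
    ∃ w : Fin r → ℤ, ∀ i, 0 < lin (σ i) w := by
  have h : ∀ i, ∃ v ∈ S, 0 < lin (σ i) v := by
    intro i
    obtain ⟨x, hx, -⟩ := hirr i
    obtain ⟨u, hu, v, hv, rfl⟩ := hSgp x
    refine ⟨v, hv, ?_⟩
    have := (hrep u).1 hu i
    rw [lin_sub] at hx
    omega
  choose v hv hpos using h
  refine ⟨∑ i, v i, fun i => ?_⟩
  rw [lin_sum]
  exact Finset.sum_pos' (fun j _ => (hrep _).1 (hv j) i) ⟨i, Finset.mem_univ i, hpos i⟩

lemma exists_lin_eq_neg_one (hSgp : ∀ x : Fin r → ℤ, ∃ a ∈ S, ∃ b ∈ S, x = a - b)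
    (hrep : ∀ x : Fin r → ℤ, x ∈ S ↔ ∀ i, 0 ≤ lin (σ i) x)
    (hirr : ∀ j, ∃ x : Fin r → ℤ, lin (σ j) x < 0 ∧ ∀ i, i ≠ j → 0 ≤ lin (σ i) x)
    (hprim : ∀ i, Finset.univ.gcd (σ i) = 1) (i : Fin s) :
    ∃ q : Fin r → ℤ, lin (σ i) q = -1 ∧ ∀ j, j ≠ i → 0 ≤ lin (σ j) q := by
  obtain ⟨w, hw⟩ := exists_forall_lin_pos hSgp hrep hirr
  obtain ⟨x, hxi, hx⟩ := hirr i
  obtain ⟨q, hq⟩ := Finset.gcd_eq_sum_mul Finset.univ (σ i)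
  rw [hprim i] at hq
  have hq' : lin (σ i) q = 1 := by
    rw [hq, lin]
  set p := lin (σ i) w • x - lin (σ i) x • w with hp
  have hpi : lin (σ i) p = 0 := by
    rw [hp, lin_sub, lin_zsmul, lin_zsmul]
    ring
  have hpj : ∀ j, j ≠ i → 1 ≤ lin (σ j) p := by
    intro j hj
    rw [hp, lin_sub, lin_zsmul, lin_zsmul]
    have h1 := mul_nonneg (hw i).le (hx j hj)
    have h2 : 0 < -lin (σ i) x * lin (σ j) w := mul_pos (by omega) (hw j)
    linarith
  refine ⟨(∑ j, |lin (σ j) q|) • p - q, ?_, fun j hj => ?_⟩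
  · rw [lin_sub, lin_zsmul, hpi, hq']
    norm_num
  · rw [lin_sub, lin_zsmul]
    have h1 : |lin (σ j) q| ≤ ∑ j, |lin (σ j) q| :=
      Finset.single_le_sum (f := fun j => |lin (σ j) q|) (fun _ _ => abs_nonneg _)
        (Finset.mem_univ j)
    have h2 := le_abs_self (lin (σ j) q)
    have h3 := abs_nonneg (lin (σ j) q)
    nlinarith [hpj j hj]

lemma Tset_nonempty (hSgp : ∀ x : Fin r → ℤ, ∃ a ∈ S, ∃ b ∈ S, x = a - b)
    (hrep : ∀ x : Fin r → ℤ, x ∈ S ↔ ∀ i, 0 ≤ lin (σ i) x)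
    (hirr : ∀ j, ∃ x : Fin r → ℤ, lin (σ j) x < 0 ∧ ∀ i, i ≠ j → 0 ≤ lin (σ i) x)
    (a : Fin s → ℤ) : (Tset σ a).Nonempty := by
  obtain ⟨w, hw⟩ := exists_forall_lin_pos hSgp hrep hirr
  refine ⟨(∑ j, |a j|) • w, fun i => ?_⟩
  rw [lin_zsmul]
  have h1 : |a i| ≤ ∑ j, |a j| :=
    Finset.single_le_sum (f := fun j => |a j|) (fun _ _ => abs_nonneg _) (Finset.mem_univ i)
  have h2 := le_abs_self (a i)
  have h3 := abs_nonneg (a i)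
  nlinarith [hw i]

/-- The exponents of the minimal monomial generators of `D(a)`. -/
def minimalGens (σ : Fin s → Fin r → ℤ) (a : Fin s → ℤ) (g : Fin n → Fin r → ℤ) :
    Set (Fin r → ℤ) :=
  {y | y ∈ Tset σ a ∧ ∀ j, y - g j ∉ Tset σ a}

/-- The sum of the support forms. -/
def totalLin (σ : Fin s → Fin r → ℤ) (x : Fin r → ℤ) : ℤ := ∑ i, lin (σ i) x

lemma totalLin_add (x y : Fin r → ℤ) : totalLin σ (x + y) = totalLin σ x + totalLin σ y := by
  simp [totalLin, lin_add, Finset.sum_add_distrib]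

lemma totalLin_sub (x y : Fin r → ℤ) : totalLin σ (x - y) = totalLin σ x - totalLin σ y := by
  simp [totalLin, lin_sub]

lemma totalLin_zsmul (t : ℤ) (x : Fin r → ℤ) : totalLin σ (t • x) = t * totalLin σ x := by
  simp only [totalLin, lin_zsmul, Finset.mul_sum]

lemma sum_le_totalLin {x : Fin r → ℤ} (hx : x ∈ Tset σ a) : ∑ i, a i ≤ totalLin σ x :=
  Finset.sum_le_sum fun i _ => hx i

lemma totalLin_pos (hSpos : ∀ x ∈ S, -x ∈ S → x = 0)
    (hrep : ∀ x : Fin r → ℤ, x ∈ S ↔ ∀ i, 0 ≤ lin (σ i) x) {x : Fin r → ℤ} (hx : x ∈ S)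
    (hx0 : x ≠ 0) : 0 < totalLin σ x := by
  have h := (hrep x).1 hx
  refine lt_of_le_of_ne (Finset.sum_nonneg fun i _ => h i) fun h0 => hx0 (hSpos x hx ?_)
  rw [hrep]
  intro i
  rw [lin_neg, (Finset.sum_eq_zero_iff_of_nonneg fun i _ => h i).1 h0.symm i (Finset.mem_univ i),
    neg_zero]

lemma exists_minimalGens_sub_mem (hSpos : ∀ x ∈ S, -x ∈ S → x = 0)
    (hrep : ∀ x : Fin r → ℤ, x ∈ S ↔ ∀ i, 0 ≤ lin (σ i) x) (hg : ∀ j, g j ∈ S)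
    (hg0 : ∀ j, g j ≠ 0) {x : Fin r → ℤ} (hx : x ∈ Tset σ a) :
    ∃ y ∈ minimalGens σ a g, x - y ∈ S := by
  induction hN : (totalLin σ x - ∑ i, a i).toNat using Nat.strong_induction_on generalizing x with
  | _ N ih =>
    by_cases hmin : ∀ j, x - g j ∉ Tset σ a
    · exact ⟨x, ⟨hx, hmin⟩, by rw [sub_self]; exact S.zero_mem⟩
    · push Not at hmin
      obtain ⟨j, hj⟩ := hmin
      have h1 := totalLin_pos hSpos hrep (hg j) (hg0 j)
      have h2 := sum_le_totalLin hj
      rw [totalLin_sub] at h2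
      obtain ⟨y, hy, hyS⟩ := ih _ (by rw [← hN, totalLin_sub]; omega) hj rfl
      refine ⟨y, hy, ?_⟩
      have := S.add_mem hyS (hg j)
      rwa [sub_right_comm, sub_add_cancel] at this

lemma exists_totalLin_minimal (hT : (Tset σ a).Nonempty) :
    ∃ y ∈ Tset σ a, ∀ x ∈ Tset σ a, totalLin σ y ≤ totalLin σ x := by
  obtain ⟨y, hy, hmin⟩ := exists_minimalFor_of_wellFoundedLT (fun x => x ∈ Tset σ a)
    (fun x => (totalLin σ x - ∑ i, a i).toNat) hT
  refine ⟨y, hy, fun x hx => ?_⟩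
  have h1 := sum_le_totalLin hx
  have h2 := sum_le_totalLin hy
  rcases le_total ((totalLin σ x - ∑ i, a i).toNat) ((totalLin σ y - ∑ i, a i).toNat) with h | h
  · have := hmin hx h
    dsimp only at this
    omega
  · omega

/-- If `D(a)` has at most `m` minimal generators, then translating `T(a)` by an element of least
total degree puts `a` in a box that depends only on `m`. -/
lemma lin_sub_lt_of_card_le (hSpos : ∀ x ∈ S, -x ∈ S → x = 0)
    (hrep : ∀ x : Fin r → ℤ, x ∈ S ↔ ∀ i, 0 ≤ lin (σ i) x) (hg : ∀ j, g j ∈ S)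
    (hg0 : ∀ j, g j ≠ 0) {m : ℕ}
    (hm : ∀ F : Finset (Fin r → ℤ), (F : Set (Fin r → ℤ)) ⊆ minimalGens σ a g → F.card ≤ m)
    {y : Fin r → ℤ} (hy : y ∈ Tset σ a) (hymin : ∀ x ∈ Tset σ a, totalLin σ y ≤ totalLin σ x)
    {i : Fin s} {q : Fin r → ℤ} (hqi : lin (σ i) q = -1) (hq : ∀ j, j ≠ i → 0 ≤ lin (σ j) q) :
    lin (σ i) y - a i < (2 + |totalLin σ q|) ^ m := by
  classical
  by_contra! hD
  set H := |totalLin σ q| with hH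
  have hH0 : 0 ≤ H := abs_nonneg _
  have hex : ∀ t : ℤ, 0 ≤ t → t ≤ lin (σ i) y - a i → ∃ z ∈ minimalGens σ a g,
      lin (σ i) z ≤ lin (σ i) y - t ∧ lin (σ i) y - t - t * H ≤ lin (σ i) z := by
    intro t ht0 ht
    have hmem : y + t • q ∈ Tset σ a := by
      intro j
      rw [lin_add, lin_zsmul]
      have hj : a j ≤ lin (σ j) y := hy j
      by_cases hji : j = i
      · subst hji
        rw [hqi]
        linarith
      · have := mul_nonneg ht0 (hq j hji)
        linarith
    obtain ⟨z, hz, hzS⟩ := exists_minimalGens_sub_mem hSpos hrep hg hg0 hmem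
    have h1 := (hrep _).1 hzS
    have h2 : lin (σ i) (y + t • q - z) ≤ totalLin σ (y + t • q - z) :=
      Finset.single_le_sum (fun j _ => h1 j) (Finset.mem_univ i)
    have h3 := h1 i
    have h4 := hymin z hz.1
    have h5 : t * totalLin σ q ≤ t * H := mul_le_mul_of_nonneg_left (le_abs_self _) ht0
    rw [lin_sub, lin_add, lin_zsmul, hqi] at h2 h3
    rw [totalLin_sub, totalLin_add, totalLin_zsmul] at h2
    exact ⟨z, hz, by linarith, by linarith⟩
  have hpow : ∀ k : Fin (m + 1), (2 + H) ^ (k : ℕ) ≤ lin (σ i) y - a i := fun k =>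
    (pow_le_pow_right₀ (by omega) (Nat.lt_succ_iff.1 k.2)).trans hD
  choose z hz hz1 hz2 using fun k : Fin (m + 1) => hex _ (by positivity) (hpow k)
  have hanti : StrictAnti fun k => lin (σ i) (z k) := by
    intro k l hkl
    have h1 : (2 + H) ^ ((k : ℕ) + 1) ≤ (2 + H) ^ (l : ℕ) :=
      pow_le_pow_right₀ (by omega) hkl
    have h2 : 0 < (2 + H) ^ (k : ℕ) := by positivity
    have h3 := hz1 l
    have h4 := hz2 k
    rw [pow_succ] at h1
    change lin (σ i) (z l) < lin (σ i) (z k)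
    linarith
  have hinj : Function.Injective z := fun k l h => hanti.injective (congrArg (lin (σ i)) h)
  have := hm (Finset.univ.image z) (by
    rw [Finset.coe_image]
    rintro _ ⟨k, -, rfl⟩
    exact hz k)
  rw [Finset.card_image_of_injective _ hinj, Finset.card_univ, Fintype.card_fin] at this
  omega

lemma card_le_of_forall_eq_zero {B : Fin s → ℤ}
    (hsep : ∀ y ∈ minimalGens σ a g, ∀ x : Fin r → ℤ,
      (∀ i, lin (σ i) y < a i + B i → lin (σ i) x = 0) → x = 0)
    (F : Finset (Fin r → ℤ)) (hF : (F : Set (Fin r → ℤ)) ⊆ minimalGens σ a g) :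
    F.card ≤ (Fintype.piFinset fun i => Finset.Icc 0 |B i|).card := by
  refine Finset.card_le_card_of_injOn (fun y i => min (lin (σ i) y - a i) |B i|) ?_ ?_
  · intro y hy
    rw [Finset.mem_coe, Fintype.mem_piFinset]
    intro i
    have : a i ≤ lin (σ i) y := (hF hy).1 i
    have := abs_nonneg (B i)
    rw [Finset.mem_Icc]
    dsimp only
    omega
  · intro y hy y' hy' h
    rw [← sub_eq_zero]
    refine hsep y (hF hy) _ fun i hi => ?_
    have h1 := congr_fun h i
    have h2 := le_abs_self (B i)
    dsimp only at h1
    rw [lin_sub]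
    omega

end Cone

lemma exists_fin_generators {r : ℕ} {S : AddSubmonoid (Fin r → ℤ)} (hSfg : S.FG) :
    ∃ (n : ℕ) (g : Fin n → Fin r → ℤ), (∀ j, g j ∈ S) ∧ (∀ j, g j ≠ 0) ∧
      AddSubmonoid.closure (Set.range g) = S := by
  classical
  obtain ⟨F, hF⟩ := hSfg
  have hcl : AddSubmonoid.closure ((F.erase 0 : Finset (Fin r → ℤ)) : Set (Fin r → ℤ)) = S := by
    rw [Finset.coe_erase, AddSubmonoid.closure_sdiff_singleton_zero, hF]
  refine ⟨(F.erase 0).card, fun j => ((F.erase 0).equivFin.symm j : Fin r → ℤ), fun j => ?_,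
    fun j => ?_, ?_⟩
  · rw [← hcl]
    exact AddSubmonoid.subset_closure ((F.erase 0).equivFin.symm j).2
  · exact (Finset.mem_erase.1 ((F.erase 0).equivFin.symm j).2).1
  · rw [← hcl]
    congr 1
    ext x
    constructor
    · rintro ⟨j, rfl⟩
      exact ((F.erase 0).equivFin.symm j).2
    · intro hx
      exact ⟨(F.erase 0).equivFin ⟨x, hx⟩, by simp⟩

/-- Corollary: only finitely many Cohen–Macaulay classes.
There exist only finitely many classes `c ∈ Cl(R) = ℤ^s/σ(ℤ^r)` such that for a
representative `a` of `c` the divisorial ideal `D(a) = K·T(a)` is a Cohen–Macaulay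
`R`-module. -/
theorem finitely_many_CohenMacaulay_classes
    {r s : ℕ} (K : Type*) [Field K]
    (S : AddSubmonoid (Fin r → ℤ)) (σ : Fin s → Fin r → ℤ)
    (hSfg : S.FG)
    (hSpos : ∀ x ∈ S, -x ∈ S → x = 0)
    (hSgp : ∀ x : Fin r → ℤ, ∃ a ∈ S, ∃ b ∈ S, x = a - b)
    (hrep : ∀ x : Fin r → ℤ, x ∈ S ↔ ∀ i, 0 ≤ lin (σ i) x)
    (hirr : ∀ j, ∃ x : Fin r → ℤ, lin (σ j) x < 0 ∧ ∀ i, i ≠ j → 0 ≤ lin (σ i) x)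
    (hprim : ∀ i, Finset.univ.gcd (σ i) = 1) :
    {c : classGroup σ | ∃ a : Fin s → ℤ, QuotientAddGroup.mk' (formsRange σ) a = c ∧
      IsCohenMacaulayMod ↥(semigroupRing K S) (irrelevantIdeal K S)
        ↥(monIdeal K S (Tset σ a))}.Finite := by
  obtain ⟨n, g, hg, hg0, hgS⟩ := exists_fin_generators hSfg
  choose q hqi hq using exists_lin_eq_neg_one hSgp hrep hirr hprim
  let m := (Fintype.piFinset fun i => Finset.Icc 0 |lin (σ i) (∑ j, g j)|).card
  let D : Fin s → ℤ := fun i => (2 + |totalLin σ (q i)|) ^ m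
  refine ((Set.finite_Icc (-D) 0).image (QuotientAddGroup.mk' (formsRange σ))).subset ?_
  rintro _ ⟨a, rfl, rs, hrs, hreg, -, hlen⟩
  have hT := Tset_nonempty hSgp hrep hirr a
  have hr : r ≤ rs.length := by
    have := le_ringKrullDim_quotient_annihilator (K := K) hSgp hT
    rw [← hlen] at this
    exact_mod_cast this
  obtain ⟨y, hy, hymin⟩ := exists_totalLin_minimal hT
  have hcard := card_le_of_forall_eq_zero (a := a) (g := g) fun y hy x hx =>
    eq_zero_of_lin_eq_zero_of_minimal hrep hg hgS hrs hreg.toIsWeaklyRegular hr hy.1 hy.2 hx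
  refine ⟨a - formsHom σ y, ⟨fun i => ?_, fun i => ?_⟩, ?_⟩
  · have := lin_sub_lt_of_card_le hSpos hrep hg hg0 hcard hy hymin (hqi i) (hq i)
    change -D i ≤ a i - lin (σ i) y
    change lin (σ i) y - a i < D i at this
    omega
  · have : a i ≤ lin (σ i) y := hy i
    change a i - lin (σ i) y ≤ 0
    omega
  · rw [map_sub, sub_eq_self]
    exact (QuotientAddGroup.eq_zero_iff _).2 ⟨y, rfl⟩
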